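/- For Algorithm II, θ_n → θ* almost surely as n → ∞. -/

import Mathlib

open MeasureTheory ProbabilityTheory Filter Finset Matrix Topology

noncomputable section

namespace QSDPaper

/-- The simplex of probability vectors on `Fin d`, identified with `𝒫(Δ°)`. -/
def simplex (d : ℕ) : Set (Fin d → ℝ) :=
  {v | (∀ i, 0 ≤ v i) ∧ ∑ i, v i = 1}

/-- The transition kernel `K[ν]` on `Δ° = Fin d`.  The full state space is
`Fin (d+1)`, with absorbing state `0` and `Δ°` embedded via `Fin.succ`;
`K[ν]_{x,y} = P_{x,y} + P_{x,0} ν(y)`. -/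
def Kmat {d : ℕ} (P : Matrix (Fin (d + 1)) (Fin (d + 1)) ℝ) (ν : Fin d → ℝ) :
    Matrix (Fin d) (Fin d) ℝ :=
  Matrix.of fun x y => P x.succ y.succ + P x.succ 0 * ν y

/-- Standing assumptions: `P` is a stochastic matrix with absorbing state `0`,
`Δ°` is an irreducible class, absorption is possible from `Δ°`, and for every
`ν` in the simplex, `pi ν` is the unique invariant distribution of `K[ν]`. -/
structure Setup (d : ℕ) (P : Matrix (Fin (d + 1)) (Fin (d + 1)) ℝ)
    (pi : (Fin d → ℝ) → Fin d → ℝ) : Prop where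
  P_nonneg : ∀ x y, 0 ≤ P x y
  P_rowsum : ∀ x, ∑ y, P x y = 1
  P_absorb : P 0 0 = 1
  P_irred : ∀ x y : Fin d, ∃ n : ℕ,
    0 < ((Matrix.of fun x y : Fin d => P x.succ y.succ) ^ n) x y
  P_killed : ∃ x : Fin d, 0 < P x.succ 0
  pi_mem : ∀ ν ∈ simplex d, pi ν ∈ simplex d
  pi_invariant : ∀ ν ∈ simplex d, ∀ y, ∑ x, pi ν x * Kmat P ν x y = pi ν y
  pi_unique : ∀ ν ∈ simplex d, ∀ w ∈ simplex d,
    (∀ y, ∑ x, w x * Kmat P ν x y = w y) → w = pi ν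

/-- `θs` is the unique quasi-stationary distribution, i.e. the unique fixed
point of `pi` in the simplex. -/
structure IsQSD (d : ℕ) (P : Matrix (Fin (d + 1)) (Fin (d + 1)) ℝ)
    (pi : (Fin d → ℝ) → Fin d → ℝ) (θs : Fin d → ℝ) : Prop where
  mem : θs ∈ simplex d
  fixed : pi θs = θs
  unique : ∀ w ∈ simplex d, pi w = w → w = θs

/-- Step sizes: `gam γs k = γ*/(k - 1 + N*)` with `N* = ⌊γ*⌋ + 1`, so that
`γ_{k+1} = γ*/(k + N*)` for `k ≥ 0`. -/
def gam (γs : ℝ) (k : ℕ) : ℝ := γs / ((k : ℝ) - 1 + (⌊γs⌋₊ + 1 : ℕ))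

/-- The particle-count sequence of Algorithm II: `a 0 = 1`, `a` is nondecreasing,
increases by at most one at each step, and the `n`-th particle is added at time
`b(n) = ⌊n^(1/ζ)⌋`, i.e. `a m = n` for `b n ≤ m < b (n+1)`. -/
structure SeqA (ζ : ℝ) (a : ℕ → ℕ) : Prop where
  zero : a 0 = 1
  mono : Monotone a
  step : ∀ n, a (n + 1) ≤ a n + 1
  count : ∀ n m : ℕ, 1 ≤ n → ⌊(n : ℝ) ^ (1 / ζ)⌋₊ ≤ m →
    m < ⌊((n : ℝ) + 1) ^ (1 / ζ)⌋₊ → a m = n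

/-- Algorithm II: one starts with a single particle and particles are added one at
a time; at time `n` there are `a n` particles.  `X n i` (for `i < a (n+1)`) are the
particle positions at time `n`; conditionally on the past they move independently
one step according to `K[θ_n]`, and when a particle is added (i.e. `a (n+2) = a (n+1) + 1`)
the new particle branches off the particle with (past-measurable) index `iota (n+1)`. -/
structure AlgorithmII (d : ℕ) (P : Matrix (Fin (d + 1)) (Fin (d + 1)) ℝ)
    (γs : ℝ) (a : ℕ → ℕ) (x0 : Fin d)
    (Ω : Type) [m0 : MeasurableSpace Ω] (μ : Measure Ω) where
  F : ℕ → MeasurableSpace Ω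
  X : ℕ → ℕ → Ω → Fin d
  iota : ℕ → Ω → ℕ
  theta : ℕ → Ω → Fin d → ℝ
  F_le : ∀ n, F n ≤ m0
  F_mono : Monotone F
  F_zero : F 0 = ⊥
  X_adapted : ∀ n i, Measurable[F n] (X n i)
  theta_adapted : ∀ n, Measurable[F n] (theta n)
  iota_adapted : ∀ n, Measurable[F n] (iota (n + 1))
  iota_range : ∀ n ω, iota (n + 1) ω < a (n + 1)
  X_zero : ∀ ω, X 0 0 ω = x0
  theta_zero : ∀ ω, theta 0 ω = fun y => if y = x0 then (1 : ℝ) else 0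
  law_no_branch : ∀ n (y : ℕ → Fin d), a (n + 2) = a (n + 1) →
    (μ[Set.indicator {ω | ∀ i < a (n + 2), X (n + 1) i ω = y i} (fun _ => (1 : ℝ)) | F n])
      =ᵐ[μ] fun ω => ∏ i ∈ Finset.range (a (n + 1)), Kmat P (theta n ω) (X n i ω) (y i)
  law_branch : ∀ n (y : ℕ → Fin d), a (n + 2) = a (n + 1) + 1 →
    (μ[Set.indicator {ω | ∀ i < a (n + 2), X (n + 1) i ω = y i} (fun _ => (1 : ℝ)) | F n])
      =ᵐ[μ] fun ω =>
        (∏ i ∈ Finset.range (a (n + 1)), Kmat P (theta n ω) (X n i ω) (y i)) *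
          Kmat P (theta n ω) (X n (iota (n + 1) ω) ω) (y (a (n + 1)))
  theta_rec : ∀ n ω x, theta (n + 1) ω x =
    (1 - gam γs (n + 1)) * theta n ω x +
      gam γs (n + 1) * (a (n + 1) : ℝ)⁻¹ *
        ∑ i ∈ Finset.range (a (n + 1)), if X (n + 1) i ω = x then (1 : ℝ) else 0

/-- A sequence contracted at rate `k * γ n` up to an error `o(γ n)`, with `γ` not summable, is
asymptotically nonpositive. -/
lemma eventually_le_of_contraction {u γ δ : ℕ → ℝ} {k : ℝ} (hk : 0 < k) (hγ0 : ∀ n, 0 ≤ γ n)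
    (hγ : Tendsto γ atTop (𝓝 0)) (hsum : Tendsto (fun n => ∑ i ∈ range n, γ i) atTop atTop)
    (hδ : Tendsto δ atTop (𝓝 0))
    (h : ∀ᶠ n in atTop, u (n + 1) ≤ (1 - k * γ n) * u n + γ n * δ n) {ε : ℝ} (hε : 0 < ε) :
    ∀ᶠ n in atTop, u n ≤ ε := by
  have h1 : ∀ᶠ n in atTop, δ n ≤ k * (ε / 2) :=
    hδ.eventually (eventually_le_nhds (by positivity))
  have h2 : ∀ᶠ n in atTop, γ n ≤ 1 / k :=
    hγ.eventually (eventually_le_nhds (by positivity))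
  obtain ⟨N, hN⟩ := eventually_atTop.1 (h.and (h1.and h2))
  have step : ∀ n ≥ N, u n - ε / 2 ≤
      Real.exp (-(k * (∑ i ∈ range n, γ i - ∑ i ∈ range N, γ i))) * max (u N - ε / 2) 0 := by
    intro n hn
    induction n, hn using Nat.le_induction with
    | base => simp
    | succ n hn ih =>
      obtain ⟨a1, a2, a3⟩ := hN n hn
      have hg : k * γ n ≤ 1 := by
        rw [le_div_iff₀ hk] at a3; linarith
      have e1 : 1 - k * γ n ≤ Real.exp (-(k * γ n)) := by
        have := Real.add_one_le_exp (-(k * γ n)); linarith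
      have e2 : u (n + 1) - ε / 2 ≤ (1 - k * γ n) * (u n - ε / 2) := by
        nlinarith [mul_le_mul_of_nonneg_left a2 (hγ0 n)]
      refine e2.trans ((mul_le_mul_of_nonneg_left ih (by linarith)).trans ?_)
      rw [sum_range_succ, show -(k * (∑ i ∈ range n, γ i + γ n - ∑ i ∈ range N, γ i)) =
        -(k * γ n) + -(k * (∑ i ∈ range n, γ i - ∑ i ∈ range N, γ i)) by ring, Real.exp_add,
        ← mul_assoc]
      gcongr
  have hlim : Tendsto (fun n => Real.exp (-(k * (∑ i ∈ range n, γ i - ∑ i ∈ range N, γ i))) *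
      max (u N - ε / 2) 0) atTop (𝓝 0) := by
    have : Tendsto (fun n => k * (∑ i ∈ range n, γ i - ∑ i ∈ range N, γ i)) atTop atTop :=
      (tendsto_atTop_add_const_right _ (-∑ i ∈ range N, γ i) hsum).const_mul_atTop hk
    simpa using (Real.tendsto_exp_neg_atTop_nhds_zero.comp this).mul_const (max (u N - ε / 2) 0)
  filter_upwards [hlim.eventually (eventually_le_nhds (show (0 : ℝ) < ε / 2 by positivity)),
    eventually_ge_atTop N] with n hn hn'
  linarith [step n hn']

/-- The normalised action of a positive matrix on row vectors. -/
def normVecMul {d : ℕ} (G : Matrix (Fin d) (Fin d) ℝ) (v : Fin d → ℝ) : Fin d → ℝ :=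
  (v ⬝ᵥ (G *ᵥ 1))⁻¹ • (v ᵥ* G)

lemma isCompact_simplex (d : ℕ) : IsCompact (simplex d) := isCompact_stdSimplex ℝ (Fin d)

/-- One step of the scalar recursion behind the contraction of the projective oscillation. -/
lemma oscillation_ratio_step {m M m' M' γ c e l δ m0 U0 c0 c1 : ℝ}
    (hm0 : 0 < m0) (hm : m0 ≤ m) (hMm : m ≤ M) (hU : (M - m) / m ≤ U0)
    (hγ : 0 ≤ γ) (hγ1 : γ ≤ 1 / 2) (hc0 : 0 < c0) (hc : c0 ≤ c) (hc1 : c ≤ c1) (hl : 0 < l)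
    (hδ : 0 < δ) (he : 0 ≤ e) (hγe : γ * e ≤ m0 / 4)
    (h1 : (1 - γ) * m + γ * c * (m * l + (M - m) * δ) - γ * e ≤ m')
    (h2 : M' ≤ (1 - γ) * M + γ * c * (M * l - (M - m) * δ) + γ * e)
    (hk : 2 * c0 * δ / (1 + c1 * l) * γ ≤ 1) :
    (M' - m') / m' ≤ (1 - 2 * c0 * δ / (1 + c1 * l) * γ) * ((M - m) / m) +
      γ * (4 * (2 + U0) / m0 * e) := by
  have hmpos : 0 < m := hm0.trans_le hm
  obtain ⟨U, hUdef⟩ : ∃ U, U = (M - m) / m := ⟨_, rfl⟩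
  have hD : M - m = U * m := by rw [hUdef]; field_simp
  have hUn : 0 ≤ U := by rw [hUdef]; exact div_nonneg (by linarith) hmpos.le
  rw [← hUdef] at hU ⊢
  set k := 2 * c0 * δ / (1 + c1 * l) with hkdef
  set C := 4 * (2 + U0) / m0 with hC
  have hcpos : 0 < c := hc0.trans_le hc
  have hc1p : 0 < c1 := hcpos.trans_le hc1
  have hkp : 0 < k := by positivity
  have hCp : 0 < C := by have : 0 ≤ U0 := hUn.trans hU; positivity
  have hCm : C * m0 = 4 * (2 + U0) := by rw [hC]; field_simp
  have hk1 : k * (1 + c1 * l) = 2 * c0 * δ := by rw [hkdef]; field_simp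
  obtain ⟨α, hα⟩ : ∃ α, α = 1 - γ + γ * c * l := ⟨_, rfl⟩
  have hγcl : 0 ≤ γ * c * l := by positivity
  have hα2 : 1 / 2 ≤ α := by linarith
  have hαU : α ≤ 1 + c1 * l := by
    have : γ * c * l ≤ c1 * l := by
      have : γ * c ≤ 1 * c1 := by gcongr; linarith
      rw [one_mul] at this
      gcongr
    linarith
  have hm'1 : α * m - γ * e ≤ m' := by
    have : 0 ≤ γ * c * ((M - m) * δ) := mul_nonneg (by positivity)
      (mul_nonneg (by linarith) hδ.le)
    rw [hα]; linarith
  have hlow : m0 / 4 ≤ α * m - γ * e := by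
    have : 1 / 2 * m0 ≤ α * m := by gcongr
    linarith
  have hm'pos : 0 < m' := by linarith
  have hD' : M' - m' ≤ (α - 2 * (γ * c * δ)) * (M - m) + 2 * (γ * e) := by
    rw [hα]; linarith
  rw [div_le_iff₀ hm'pos]
  have hr : 0 ≤ (1 - k * γ) * U + γ * (C * e) := by
    have : 0 ≤ 1 - k * γ := by linarith
    positivity
  refine hD'.trans (le_trans ?_ (mul_le_mul_of_nonneg_left hm'1 hr))
  rw [hD]
  have i1 : k * α ≤ 2 * c * δ := by
    calc k * α ≤ k * (1 + c1 * l) := by gcongr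
      _ = 2 * c0 * δ := hk1
      _ ≤ 2 * c * δ := by gcongr
  have i1' : 0 ≤ γ * (U * m) * (2 * c * δ - k * α) :=
    mul_nonneg (by positivity) (by linarith)
  have i2 : 2 + U + C * (γ * e) ≤ C * (α * m) := by
    have a1 : C * (γ * e) ≤ C * (m0 / 4) := by gcongr
    have a2 : C * (m0 / 2) ≤ C * (α * m) := by
      have : 1 / 2 * m0 ≤ α * m := by gcongr
      gcongr; linarith
    linarith
  have i2' : 0 ≤ γ * e * (C * (α * m) - (2 + U + C * (γ * e))) :=
    mul_nonneg (by positivity) (by linarith)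
  have i3 : 0 ≤ γ * e * (k * γ * U) := by positivity
  linarith

lemma tendsto_sub_of_isCompact {E F : Type*} [NormedAddCommGroup E] [NormedAddCommGroup F]
    {K : Set E} (hK : IsCompact K) {f : E → F} (hf : ∀ x ∈ K, ContinuousAt f x)
    {x y : ℕ → E} (hx : ∀ n, x n ∈ K) (hxy : Tendsto (fun n => y n - x n) atTop (𝓝 0)) :
    Tendsto (fun n => f (y n) - f (x n)) atTop (𝓝 0) := by
  rw [Metric.tendsto_atTop]
  intro ε hε
  have h := hK.uniformContinuousAt_of_continuousAt f hf (Metric.dist_mem_uniformity hε)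
  obtain ⟨δ, hδ, hs⟩ := Metric.mem_uniformity_dist.1 h
  obtain ⟨N, hN⟩ := Metric.tendsto_atTop.1 hxy δ hδ
  refine ⟨N, fun n hn => ?_⟩
  have h1 : dist (x n) (y n) < δ := by
    have := hN n hn
    rwa [dist_zero_right, ← dist_eq_norm, dist_comm] at this
  have h2 := hs h1 (hx n)
  simp only [Set.mem_ofPred_eq] at h2
  rwa [dist_zero_right, ← dist_eq_norm, dist_comm]

lemma continuousAt_normVecMul {d : ℕ} {G : Matrix (Fin d) (Fin d) ℝ} {v : Fin d → ℝ}
    (hv : v ⬝ᵥ (G *ᵥ 1) ≠ 0) : ContinuousAt (normVecMul G) v := by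
  unfold normVecMul
  have h1 : Continuous fun v : Fin d → ℝ => v ⬝ᵥ (G *ᵥ 1) :=
    Continuous.dotProduct continuous_id continuous_const
  have h2 : Continuous fun v : Fin d → ℝ => v ᵥ* G :=
    Continuous.matrix_vecMul continuous_id continuous_const
  exact (h1.continuousAt.inv₀ hv).smul h2.continuousAt

lemma dotProduct_bounds {d : ℕ} {g v : Fin d → ℝ} {a b : ℝ} (hv : v ∈ simplex d)
    (ha : ∀ i, a ≤ g i) (hb : ∀ i, g i ≤ b) : a ≤ v ⬝ᵥ g ∧ v ⬝ᵥ g ≤ b := by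
  constructor
  · calc a = ∑ i, v i * a := by rw [← sum_mul, hv.2, one_mul]
      _ ≤ v ⬝ᵥ g := sum_le_sum fun i _ => mul_le_mul_of_nonneg_left (ha i) (hv.1 i)
  · calc v ⬝ᵥ g ≤ ∑ i, v i * b := sum_le_sum fun i _ => mul_le_mul_of_nonneg_left (hb i) (hv.1 i)
      _ = b := by rw [← sum_mul, hv.2, one_mul]

lemma exists_bounds_of_pos {ι : Type*} [Finite ι] {f : ι → ℝ} (hf : ∀ i, 0 < f i) :
    ∃ a b : ℝ, 0 < a ∧ 0 < b ∧ ∀ i, a ≤ f i ∧ f i ≤ b := by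
  rcases isEmpty_or_nonempty ι with h | h
  · exact ⟨1, 1, one_pos, one_pos, fun i => (h.false i).elim⟩
  · obtain ⟨i, hi⟩ := Finite.exists_min f
    obtain ⟨j, hj⟩ := Finite.exists_max f
    exact ⟨f i, f j, hf i, hf j, fun k => ⟨hi k, hj k⟩⟩

lemma mulVec_one_pos {d : ℕ} (hd : 0 < d) {G : Matrix (Fin d) (Fin d) ℝ}
    (hG : ∀ x y, 0 < G x y) (x : Fin d) : 0 < (G *ᵥ 1) x := by
  have : Nonempty (Fin d) := ⟨⟨0, hd⟩⟩
  simp only [mulVec, dotProduct, Pi.one_apply, mul_one]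
  exact sum_pos (fun y _ => hG x y) univ_nonempty

lemma exists_le_normVecMul {d : ℕ} (hd : 0 < d) {G : Matrix (Fin d) (Fin d) ℝ}
    (hG : ∀ x y, 0 < G x y) :
    ∃ ε > 0, ∀ v ∈ simplex d, ∀ i, ε ≤ normVecMul G v i := by
  obtain ⟨a, b, ha, hb, h⟩ := exists_bounds_of_pos (f := fun p : Fin d × Fin d => G p.1 p.2)
    fun p => hG p.1 p.2
  obtain ⟨a', b', ha', hb', h'⟩ := exists_bounds_of_pos (mulVec_one_pos hd hG)
  refine ⟨b'⁻¹ * a, by positivity, fun v hv i => ?_⟩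
  have h1 := dotProduct_bounds hv (fun i => (h' i).1) (fun i => (h' i).2)
  have h2 := dotProduct_bounds hv (g := fun x => G x i) (fun x => (h (x, i)).1)
    (fun x => (h (x, i)).2)
  have h3 : 0 < v ⬝ᵥ (G *ᵥ 1) := ha'.trans_le h1.1
  simp only [normVecMul, Pi.smul_apply, smul_eq_mul]
  exact mul_le_mul (inv_anti₀ h3 h1.2) h2.1 ha.le (inv_nonneg.2 h3.le)

lemma le_vecMul_of_le {d : ℕ} {G : Matrix (Fin d) (Fin d) ℝ} (hG : ∀ x y, 0 < G x y)
    {w v : Fin d → ℝ} {l δ m M : ℝ} (hw : w ᵥ* G = l • w) (hδ : ∀ i j, δ * w i ≤ w j * G j i)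
    (hm : ∀ i, m * w i ≤ v i) (hmM : m ≤ M) {j : Fin d} (hj : v j = M * w j) (i : Fin d) :
    (m * l + (M - m) * δ) * w i ≤ (v ᵥ* G) i := by
  have h1 : ∑ x, w x * G x i = l * w i := by
    simpa [vecMul, dotProduct] using congrFun hw i
  have h2 : (v ᵥ* G) i = m * (l * w i) + ∑ x, (v x - m * w x) * G x i := by
    rw [← h1, mul_sum, ← sum_add_distrib]
    simp only [vecMul, dotProduct]
    exact sum_congr rfl fun x _ => by ring
  have h3 : (v j - m * w j) * G j i ≤ ∑ x, (v x - m * w x) * G x i :=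
    single_le_sum (f := fun x => (v x - m * w x) * G x i)
      (fun x _ => mul_nonneg (sub_nonneg.2 (hm x)) (hG x i).le) (mem_univ j)
  have h4 : (M - m) * (δ * w i) ≤ (M - m) * (w j * G j i) :=
    mul_le_mul_of_nonneg_left (hδ i j) (by linarith)
  rw [h2]
  rw [hj] at h3
  linarith

/-- Any perturbed Robbins--Monro iteration for the vector field `normVecMul G v - v` which stays
close to the simplex converges to the positive left eigenvector of `G`. -/
lemma tendsto_of_perturbed_normVecMul {d : ℕ} (hd : 0 < d) {G : Matrix (Fin d) (Fin d) ℝ}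
    (hG : ∀ x y, 0 < G x y) {θs : Fin d → ℝ} (hθs : θs ∈ simplex d)
    (hfix : normVecMul G θs = θs) {γ : ℕ → ℝ} (hγ0 : ∀ n, 0 ≤ γ n)
    (hγ : Tendsto γ atTop (𝓝 0)) (hsum : Tendsto (fun n => ∑ i ∈ range n, γ i) atTop atTop)
    {θ φ r : ℕ → Fin d → ℝ} (hθ : ∀ n, θ n ∈ simplex d)
    (hφθ : Tendsto (fun n => φ n - θ n) atTop (𝓝 0)) (hr : Tendsto r atTop (𝓝 0))
    (hrec : ∀ n, φ (n + 1) = φ n + γ n • (normVecMul G (φ n) - φ n + r n)) :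
    Tendsto φ atTop (𝓝 θs) := by
  have : Nonempty (Fin d) := ⟨⟨0, hd⟩⟩
  obtain ⟨ε, hε, hεle⟩ := exists_le_normVecMul hd hG
  obtain ⟨a, b, ha, hb, hab⟩ := exists_bounds_of_pos (f := fun p : Fin d × Fin d => G p.1 p.2)
    fun p => hG p.1 p.2
  obtain ⟨g0, g1, hg0, hg1, hg⟩ := exists_bounds_of_pos (mulVec_one_pos hd hG)
  have hdot : ∀ v ∈ simplex d, g0 ≤ v ⬝ᵥ (G *ᵥ 1) ∧ v ⬝ᵥ (G *ᵥ 1) ≤ g1 := fun v hv =>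
    dotProduct_bounds hv (fun i => (hg i).1) (fun i => (hg i).2)
  have hθspos : ∀ i, ε ≤ θs i := fun i => by
    have := hεle θs hθs i; rwa [hfix] at this
  have hθs1 : ∀ i, θs i ≤ 1 := fun i => hθs.2 ▸ single_le_sum (fun j _ => hθs.1 j) (mem_univ i)
  obtain ⟨l, hl⟩ : ∃ l, l = θs ⬝ᵥ (G *ᵥ 1) := ⟨_, rfl⟩
  have hlpos : 0 < l := by rw [hl]; exact hg0.trans_le (hdot θs hθs).1
  have heig : θs ᵥ* G = l • θs := by
    rw [normVecMul, ← hl] at hfix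
    rw [← inv_smul_eq_iff₀ hlpos.ne', hfix]
  have hcomp : ∀ i, Tendsto (fun n => φ n i - θ n i) atTop (𝓝 0) := fun i =>
    (tendsto_pi_nhds.1 hφθ) i
  have hri : ∀ i, Tendsto (fun n => r n i) atTop (𝓝 0) := fun i => (tendsto_pi_nhds.1 hr) i
  have hnv : ∀ i, Tendsto (fun n => normVecMul G (φ n) i - normVecMul G (θ n) i) atTop (𝓝 0) :=
    fun i => (tendsto_pi_nhds.1 (tendsto_sub_of_isCompact (isCompact_simplex d)
      (fun x hx => continuousAt_normVecMul (hg0.trans_le (hdot x hx).1).ne') hθ hφθ)) i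
  -- lower bound on the coordinates
  have hlow : ∀ᶠ n in atTop, ∀ i, ε / 2 ≤ φ n i := by
    refine eventually_all.2 fun i => ?_
    have := eventually_le_of_contraction (u := fun n => ε - φ n i) (k := 1) one_pos hγ0 hγ hsum
      (δ := fun n => -(normVecMul G (φ n) i - normVecMul G (θ n) i) - r n i)
      (by simpa using (hnv i).neg.sub (hri i))
      (Eventually.of_forall fun n => by
        have h1 := mul_le_mul_of_nonneg_left (hεle (θ n) (hθ n) i) (hγ0 n)
        have h2 : φ (n + 1) i = φ n i + γ n * (normVecMul G (φ n) i - φ n i + r n i) := by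
          rw [hrec n]; simp only [Pi.add_apply, Pi.smul_apply, Pi.sub_apply, smul_eq_mul]
        simp only [h2]
        linarith) (half_pos hε)
    filter_upwards [this] with n hn
    linarith
  have hup : ∀ᶠ n in atTop, ∀ i, φ n i ≤ 2 := by
    refine eventually_all.2 fun i => ?_
    filter_upwards [(hcomp i).eventually (eventually_le_nhds one_pos)] with n hn
    have : θ n i ≤ 1 := (hθ n).2 ▸ single_le_sum (fun j _ => (hθ n).1 j) (mem_univ i)
    linarith
  have hφdot : ∀ᶠ n in atTop, g0 / 2 ≤ φ n ⬝ᵥ (G *ᵥ 1) ∧ φ n ⬝ᵥ (G *ᵥ 1) ≤ 2 * g1 := by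
    have : Tendsto (fun n => (φ n - θ n) ⬝ᵥ (G *ᵥ 1)) atTop (𝓝 0) := by
      have := ((Continuous.dotProduct continuous_id
        (continuous_const (y := G *ᵥ 1))).tendsto (0 : Fin d → ℝ)).comp hφθ
      simpa [Function.comp_def] using this
    filter_upwards [this.eventually (eventually_le_nhds hg1),
      this.eventually (eventually_ge_nhds (show -(g0 / 2) < 0 by linarith))] with n h1 h2
    rw [sub_dotProduct] at h1 h2
    constructor <;> linarith [hdot (θ n) (hθ n)]
  have hsumφ : Tendsto (fun n => ∑ i, φ n i) atTop (𝓝 1) := by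
    have : Tendsto (fun n => ∑ i, (φ n i - θ n i) + 1) atTop (𝓝 (∑ i : Fin d, (0 : ℝ) + 1)) :=
      (tendsto_finsetSum _ fun i _ => hcomp i).add_const 1
    simp only [sum_const_zero, zero_add] at this
    refine this.congr fun n => ?_
    rw [sum_sub_distrib, (hθ n).2]; ring
  -- the projective oscillation
  set m : ℕ → ℝ := fun n => ⨅ i, φ n i / θs i with hm
  set M : ℕ → ℝ := fun n => ⨆ i, φ n i / θs i with hM
  have hθsp : ∀ i, 0 < θs i := fun i => hε.trans_le (hθspos i)
  have hmle : ∀ n i, m n * θs i ≤ φ n i := fun n i => by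
    rw [← le_div_iff₀ (hθsp i)]
    exact ciInf_le (Set.finite_range _).bddBelow i
  have hleM : ∀ n i, φ n i ≤ M n * θs i := fun n i => by
    rw [← div_le_iff₀ (hθsp i)]
    exact le_ciSup (f := fun i => φ n i / θs i) (Set.finite_range _).bddAbove i
  have hmM : ∀ n, m n ≤ M n := fun n => by
    have i := Classical.arbitrary (Fin d)
    exact le_of_mul_le_mul_right ((hmle n i).trans (hleM n i)) (hθsp i)
  have hmex : ∀ n, ∃ j, φ n j = m n * θs j := fun n => by
    obtain ⟨j, hj⟩ := exists_eq_ciInf_of_finite (f := fun i => φ n i / θs i)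
    exact ⟨j, by rw [← div_eq_iff (hθsp j).ne']; exact hj⟩
  have hMex : ∀ n, ∃ j, φ n j = M n * θs j := fun n => by
    obtain ⟨j, hj⟩ := exists_eq_ciSup_of_finite (f := fun i => φ n i / θs i)
    exact ⟨j, by rw [← div_eq_iff (hθsp j).ne']; exact hj⟩
  have hm0 : ∀ᶠ n in atTop, ε / 2 ≤ m n := by
    filter_upwards [hlow] with n hn
    refine le_ciInf fun i => ?_
    rw [le_div_iff₀ (hθsp i)]
    have := hn i
    nlinarith [hθs1 i, hθsp i]
  have hM0 : ∀ᶠ n in atTop, M n ≤ 2 / ε := by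
    filter_upwards [hup] with n hn
    refine ciSup_le fun i => ?_
    exact div_le_div₀ (by norm_num) (hn i) hε (hθspos i)
  obtain ⟨δ, hδ⟩ : ∃ δ, δ = ε * a := ⟨_, rfl⟩
  have hδpos : 0 < δ := by rw [hδ]; positivity
  have hδle : ∀ i j, δ * θs i ≤ θs j * G j i := fun i j => by
    rw [hδ]
    calc ε * a * θs i ≤ ε * a * 1 := by gcongr; exact hθs1 i
      _ ≤ θs j * G j i := by
        rw [mul_one]
        exact mul_le_mul (hθspos j) (hab (j, i)).1 ha.le (hθsp j).le
  have he : Tendsto (fun n => ‖r n‖ / ε) atTop (𝓝 0) := by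
    simpa using hr.norm.div_const ε
  have hγe : ∀ᶠ n in atTop, γ n * (‖r n‖ / ε) ≤ ε / 2 / 4 := by
    have : Tendsto (fun n => γ n * (‖r n‖ / ε)) atTop (𝓝 0) := by simpa using hγ.mul he
    exact this.eventually (eventually_le_nhds (by positivity))
  have hre : ∀ n i, |r n i| ≤ ‖r n‖ / ε * θs i := fun n i => by
    calc |r n i| ≤ ‖r n‖ := norm_le_pi_norm (r n) i
      _ = ‖r n‖ / ε * ε := by field_simp
      _ ≤ _ := by gcongr; exact hθspos i
  set k := 2 * (2 * g1)⁻¹ * δ / (1 + (g0 / 2)⁻¹ * l) with hk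
  have hkpos : 0 < k := by positivity
  have hkγ : ∀ᶠ n in atTop, k * γ n ≤ 1 := by
    have : Tendsto (fun n => k * γ n) atTop (𝓝 0) := by simpa using hγ.const_mul k
    exact this.eventually (eventually_le_nhds one_pos)
  have hUle : ∀ e > 0, ∀ᶠ n in atTop, (M n - m n) / m n ≤ e := by
    intro e he0
    refine eventually_le_of_contraction hkpos hγ0 hγ hsum
      (δ := fun n => 4 * (2 + 2 / ε / (ε / 2)) / (ε / 2) * (‖r n‖ / ε))
      (by simpa using he.const_mul (4 * (2 + 2 / ε / (ε / 2)) / (ε / 2))) ?_ he0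
    filter_upwards [hm0, hM0, hγe, hkγ, hφdot,
      hγ.eventually (eventually_le_nhds (show (0 : ℝ) < 1 / 2 by norm_num))]
      with n h1 h2 h3 h4 h5 h6
    have hmn : 0 < m n := lt_of_lt_of_le (by positivity) h1
    have hcpos : 0 < φ n ⬝ᵥ (G *ᵥ 1) := lt_of_lt_of_le (by positivity) h5.1
    have hnext : ∀ i, φ (n + 1) i = (1 - γ n) * φ n i +
        γ n * (φ n ⬝ᵥ (G *ᵥ 1))⁻¹ * (φ n ᵥ* G) i + γ n * r n i := fun i => by
      rw [hrec n]; simp only [normVecMul, Pi.add_apply, Pi.smul_apply, Pi.sub_apply, smul_eq_mul]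
      ring
    have hγc : 0 ≤ γ n * (φ n ⬝ᵥ (G *ᵥ 1))⁻¹ := mul_nonneg (hγ0 n) (inv_nonneg.2 hcpos.le)
    have h1γ : 0 ≤ 1 - γ n := by linarith
    refine oscillation_ratio_step (c := (φ n ⬝ᵥ (G *ᵥ 1))⁻¹) (by positivity) h1 (hmM n) ?_ (hγ0 n)
      h6 (by positivity) (inv_anti₀ hcpos h5.2) (inv_anti₀ (by positivity) h5.1) hlpos hδpos
      (by positivity) h3 ?_ ?_ h4
    · have : M n - m n ≤ 2 / ε := by linarith
      exact div_le_div₀ (by positivity) this (by positivity) h1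
    · obtain ⟨j, hj⟩ := hMex n
      refine le_ciInf fun i => ?_
      rw [le_div_iff₀ (hθsp i), hnext i]
      have b1 := mul_le_mul_of_nonneg_left
        (le_vecMul_of_le hG heig hδle (hmle n) (hmM n) hj i) hγc
      have b2 := mul_le_mul_of_nonneg_left (hmle n i) h1γ
      have b3 := mul_le_mul_of_nonneg_left (neg_le_of_abs_le (hre n i)) (hγ0 n)
      linarith
    · obtain ⟨j, hj⟩ := hmex n
      refine ciSup_le fun i => ?_
      rw [div_le_iff₀ (hθsp i), hnext i]
      have b0 := le_vecMul_of_le hG heig hδle (v := -φ n) (m := -M n) (M := -m n)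
        (fun i => by have := hleM n i; simp only [Pi.neg_apply]; linarith)
        (by linarith [hmM n]) (j := j) (by simp [hj]) i
      rw [neg_vecMul, Pi.neg_apply] at b0
      have b1 := mul_le_mul_of_nonneg_left b0 hγc
      have b2 := mul_le_mul_of_nonneg_left (hleM n i) h1γ
      have b3 := mul_le_mul_of_nonneg_left (le_of_abs_le (hre n i)) (hγ0 n)
      linarith
  have hU0 : ∀ᶠ n in atTop, 0 ≤ (M n - m n) / m n := by
    filter_upwards [hm0] with n hn
    exact div_nonneg (by linarith [hmM n]) (le_trans (by positivity) hn)
  have hU : Tendsto (fun n => (M n - m n) / m n) atTop (𝓝 0) := by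
    rw [Metric.tendsto_nhds]
    intro e he0
    filter_upwards [hU0, hUle (e / 2) (half_pos he0)] with n h1 h2
    rw [Real.dist_eq, sub_zero, abs_of_nonneg h1]; linarith
  rw [tendsto_pi_nhds]
  intro i
  have key : Tendsto (fun n => φ n i - (∑ j, φ n j) * θs i) atTop (𝓝 0) := by
    refine squeeze_zero_norm' ?_ (by simpa using hU.const_mul (2 / ε))
    filter_upwards [hm0, hM0] with n h1 h2
    have hmn : 0 < m n := lt_of_lt_of_le (by positivity) h1
    have s1 : m n ≤ ∑ j, φ n j := by
      calc m n = ∑ j, m n * θs j := by rw [← mul_sum, hθs.2, mul_one]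
        _ ≤ _ := sum_le_sum fun j _ => hmle n j
    have s2 : ∑ j, φ n j ≤ M n := by
      calc _ ≤ ∑ j, M n * θs j := sum_le_sum fun j _ => hleM n j
        _ = M n := by rw [← mul_sum, hθs.2, mul_one]
    have t1 : M n - m n ≤ 2 / ε * ((M n - m n) / m n) := by
      rw [mul_div_assoc', le_div_iff₀ hmn, mul_comm]
      exact mul_le_mul_of_nonneg_right (by linarith [hmM n]) (by linarith [hmM n])
    refine le_trans ?_ t1
    rw [Real.norm_eq_abs, abs_le]
    have u1 := mul_le_mul_of_nonneg_right s1 (hθsp i).le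
    have u2 := mul_le_mul_of_nonneg_right s2 (hθsp i).le
    have u3 := mul_le_mul_of_nonneg_left (hθs1 i) (sub_nonneg.2 (hmM n))
    constructor <;> linarith [hmle n i, hleM n i]
  have := key.add (hsumφ.mul_const (θs i))
  simpa using this
/-- The solution operator of the Poisson equation of the kernel `Q + q θ`, where `G` is the inverse
of `1 - Q`. -/
def poissonSol {d : ℕ} (G : Matrix (Fin d) (Fin d) ℝ) (v θ : Fin d → ℝ) : Fin d → ℝ :=
  v ᵥ* G - (v ⬝ᵥ (G *ᵥ 1)) • normVecMul G θ

lemma poissonSol_add {d : ℕ} (G : Matrix (Fin d) (Fin d) ℝ) (v w θ : Fin d → ℝ) :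
    poissonSol G (v + w) θ = poissonSol G v θ + poissonSol G w θ := by
  simp only [poissonSol, add_vecMul, add_dotProduct, add_smul]
  abel

lemma poissonSol_sub {d : ℕ} (G : Matrix (Fin d) (Fin d) ℝ) (v w θ : Fin d → ℝ) :
    poissonSol G (v - w) θ = poissonSol G v θ - poissonSol G w θ := by
  simp only [poissonSol, sub_vecMul, sub_dotProduct, sub_smul]
  abel

lemma poisson_equation {d : ℕ} {G Q : Matrix (Fin d) (Fin d) ℝ} (hGQ : (1 - Q) * G = 1)
    {η θ : Fin d → ℝ} (hη : η ∈ simplex d) (hθ : θ ⬝ᵥ (G *ᵥ 1) ≠ 0) (c : ℝ) :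
    poissonSol G (η - (η ᵥ* Q + c • θ)) θ = η - normVecMul G θ := by
  have h1 : η - (η ᵥ* Q + c • θ) = η ᵥ* (1 - Q) - c • θ := by
    rw [vecMul_sub, vecMul_one, sub_sub]
  have h2 : (η - (η ᵥ* Q + c • θ)) ᵥ* G = η - c • (θ ᵥ* G) := by
    rw [h1, sub_vecMul, vecMul_vecMul, hGQ, vecMul_one, smul_vecMul]
  have h3 : (η - (η ᵥ* Q + c • θ)) ⬝ᵥ (G *ᵥ 1) = 1 - c * (θ ⬝ᵥ (G *ᵥ 1)) := by
    rw [dotProduct_mulVec, h2, sub_dotProduct, smul_dotProduct, dotProduct_mulVec,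
      dotProduct_one, hη.2, smul_eq_mul]
  rw [poissonSol, h2, h3]
  ext i
  simp only [normVecMul, Pi.sub_apply, Pi.smul_apply, smul_eq_mul]
  field_simp
  ring

/-- If the occupation measures `η` asymptotically follow the kernels `Q + q θ` and `θ` is the
stochastic approximation driven by `η`, then `θ` converges to the positive left eigenvector of
`(1 - Q)⁻¹`. -/
lemma tendsto_of_asymptotic_kernel {d : ℕ} (hd : 0 < d) {G Q : Matrix (Fin d) (Fin d) ℝ}
    (hG : ∀ x y, 0 < G x y) (hGQ : (1 - Q) * G = 1) {q θs : Fin d → ℝ} (hθs : θs ∈ simplex d)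
    (hfix : normVecMul G θs = θs) {γ : ℕ → ℝ} (hγ0 : ∀ n, 0 < γ n)
    (hγ : Tendsto γ atTop (𝓝 0)) (hsum : Tendsto (fun n => ∑ i ∈ range n, γ i) atTop atTop)
    (hratio : Tendsto (fun n => γ (n + 1) / γ n) atTop (𝓝 1))
    {θ η : ℕ → Fin d → ℝ} (hθ : ∀ n, θ n ∈ simplex d) (hη : ∀ n, η n ∈ simplex d)
    (hrec : ∀ n, θ (n + 1) = θ n + γ n • (η (n + 1) - θ n))
    (herr : Tendsto (fun n => η (n + 1) - (η n ᵥ* Q + (η n ⬝ᵥ q) • θ n)) atTop (𝓝 0)) :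
    Tendsto θ atTop (𝓝 θs) := by
  obtain ⟨g0, g1, hg0, hg1, hg⟩ := exists_bounds_of_pos (mulVec_one_pos hd hG)
  have hdot : ∀ v ∈ simplex d, g0 ≤ v ⬝ᵥ (G *ᵥ 1) ∧ v ⬝ᵥ (G *ᵥ 1) ≤ g1 := fun v hv =>
    dotProduct_bounds hv (fun i => (hg i).1) (fun i => (hg i).2)
  have hdot0 : ∀ v ∈ simplex d, v ⬝ᵥ (G *ᵥ 1) ≠ 0 := fun v hv =>
    (hg0.trans_le (hdot v hv).1).ne'
  have hcont : ∀ v ∈ simplex d, ContinuousAt (normVecMul G) v := fun v hv =>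
    continuousAt_normVecMul (hdot0 v hv)
  have hdotc : Continuous fun v : Fin d → ℝ => v ⬝ᵥ (G *ᵥ 1) :=
    Continuous.dotProduct continuous_id continuous_const
  have hvmc : Continuous fun v : Fin d → ℝ => v ᵥ* G :=
    Continuous.matrix_vecMul continuous_id continuous_const
  obtain ⟨CN, hCN⟩ := (isCompact_simplex d).exists_bound_of_continuousOn
    (fun v hv => (hcont v hv).continuousWithinAt)
  obtain ⟨CG, hCG⟩ := (isCompact_simplex d).exists_bound_of_continuousOn
    (f := fun v => v ᵥ* G) hvmc.continuousOn
  have hCW : ∀ v ∈ simplex d, ∀ w ∈ simplex d, ‖poissonSol G v w‖ ≤ CG + g1 * CN := by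
    intro v hv w hw
    refine (norm_sub_le _ _).trans (add_le_add (hCG v hv) ?_)
    rw [norm_smul, Real.norm_eq_abs, abs_of_pos (hg0.trans_le (hdot v hv).1)]
    exact mul_le_mul (hdot v hv).2 (hCN w hw) (norm_nonneg _) hg1.le
  have hnorm : ∀ v ∈ simplex d, ‖v‖ ≤ 1 := fun v hv => by
    refine (pi_norm_le_iff_of_nonneg zero_le_one).2 fun i => ?_
    rw [Real.norm_eq_abs, abs_of_nonneg (hv.1 i)]
    exact hv.2 ▸ single_le_sum (fun j _ => hv.1 j) (mem_univ i)
  have hθdiff : Tendsto (fun n => θ (n + 1) - θ n) atTop (𝓝 0) := by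
    refine squeeze_zero_norm (a := fun n => γ n * 2) (fun n => ?_) (by simpa using hγ.mul_const 2)
    rw [hrec n, add_sub_cancel_left, norm_smul, Real.norm_eq_abs, abs_of_pos (hγ0 n)]
    refine mul_le_mul_of_nonneg_left ((norm_sub_le _ _).trans ?_) (hγ0 n).le
    linarith [hnorm _ (hη (n + 1)), hnorm _ (hθ n)]
  obtain ⟨φ, hφ⟩ : ∃ φ : ℕ → Fin d → ℝ,
    φ = fun n => θ n + γ n • poissonSol G (η (n + 1)) (θ (n + 1)) := ⟨_, rfl⟩
  have hφθ : Tendsto (fun n => φ n - θ n) atTop (𝓝 0) := by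
    refine squeeze_zero_norm (a := fun n => γ n * (CG + g1 * CN)) (fun n => ?_)
      (by simpa using hγ.mul_const (CG + g1 * CN))
    rw [hφ]
    simp only [add_sub_cancel_left]
    rw [norm_smul, Real.norm_eq_abs, abs_of_pos (hγ0 n)]
    exact mul_le_mul_of_nonneg_left (hCW _ (hη _) _ (hθ _)) (hγ0 n).le
  obtain ⟨e, he⟩ : ∃ e : ℕ → Fin d → ℝ,
    e = fun n => η (n + 1) - (η n ᵥ* Q + (η n ⬝ᵥ q) • θ n) := ⟨_, rfl⟩
  rw [← he] at herr
  have hpoisson : ∀ n, η n - normVecMul G (θ n) =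
      poissonSol G (η n) (θ n) - poissonSol G (η (n + 1)) (θ n) + poissonSol G (e n) (θ n) := by
    intro n
    rw [← poisson_equation hGQ (hη n) (hdot0 _ (hθ n)) (η n ⬝ᵥ q), ← poissonSol_sub,
      ← poissonSol_add]
    congr 1
    simp only [he]
    abel
  have hφlim : Tendsto φ atTop (𝓝 θs) := by
    refine tendsto_of_perturbed_normVecMul hd hG hθs hfix (fun n => (hγ0 n).le) hγ hsum hθ hφθ
      (r := fun n => (normVecMul G (θ (n + 1)) - normVecMul G (φ n)) + (φ n - θ n) +
        poissonSol G (e (n + 1)) (θ (n + 1)) +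
        ((γ (n + 1) / γ n) • poissonSol G (η (n + 2)) (θ (n + 2)) -
          poissonSol G (η (n + 2)) (θ (n + 1)))) ?_ ?_
    · have l1 : Tendsto (fun n => normVecMul G (θ (n + 1)) - normVecMul G (φ n)) atTop (𝓝 0) := by
        have := (tendsto_sub_of_isCompact (isCompact_simplex d) hcont (fun n => hθ (n + 1))
          (y := φ) (by simpa using hφθ.sub hθdiff)).neg
        simpa using this
      have l2 : Tendsto (fun n => poissonSol G (e (n + 1)) (θ (n + 1))) atTop (𝓝 0) := by
        have herr' := herr.comp (tendsto_add_atTop_nat 1)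
        have a1 : Tendsto (fun n => e (n + 1) ᵥ* G) atTop (𝓝 0) := by
          simpa [Function.comp_def] using (hvmc.tendsto 0).comp herr'
        have a2 : Tendsto (fun n => e (n + 1) ⬝ᵥ (G *ᵥ 1)) atTop (𝓝 0) := by
          simpa [Function.comp_def] using (hdotc.tendsto 0).comp herr'
        have a3 : Tendsto (fun n => (e (n + 1) ⬝ᵥ (G *ᵥ 1)) • normVecMul G (θ (n + 1)))
            atTop (𝓝 0) := by
          refine squeeze_zero_norm (a := fun n => ‖e (n + 1) ⬝ᵥ (G *ᵥ 1)‖ * CN) (fun n => ?_)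
            (by simpa using a2.norm.mul_const CN)
          rw [norm_smul]
          exact mul_le_mul_of_nonneg_left (hCN _ (hθ _)) (norm_nonneg _)
        simpa [poissonSol] using a1.sub a3
      have l3 : Tendsto (fun n => (γ (n + 1) / γ n) • poissonSol G (η (n + 2)) (θ (n + 2)) -
          poissonSol G (η (n + 2)) (θ (n + 1))) atTop (𝓝 0) := by
        have a1 : Tendsto (fun n => (γ (n + 1) / γ n - 1) • poissonSol G (η (n + 2)) (θ (n + 2)))
            atTop (𝓝 0) := by
          have hr0 : Tendsto (fun n => γ (n + 1) / γ n - 1) atTop (𝓝 0) := by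
            simpa using hratio.sub_const 1
          refine squeeze_zero_norm (a := fun n => ‖γ (n + 1) / γ n - 1‖ * (CG + g1 * CN))
            (fun n => ?_) (by simpa using hr0.norm.mul_const (CG + g1 * CN))
          rw [norm_smul]
          exact mul_le_mul_of_nonneg_left (hCW _ (hη _) _ (hθ _)) (norm_nonneg _)
        have a2 : Tendsto (fun n => (η (n + 2) ⬝ᵥ (G *ᵥ 1)) •
            (normVecMul G (θ (n + 2)) - normVecMul G (θ (n + 1)))) atTop (𝓝 0) := by
          have := tendsto_sub_of_isCompact (isCompact_simplex d) hcont (fun n => hθ (n + 1))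
            (y := fun n => θ (n + 2)) (hθdiff.comp (tendsto_add_atTop_nat 1))
          refine squeeze_zero_norm (a := fun n => g1 *
            ‖normVecMul G (θ (n + 2)) - normVecMul G (θ (n + 1))‖) (fun n => ?_)
            (by simpa using this.norm.const_mul g1)
          rw [norm_smul, Real.norm_eq_abs, abs_of_pos (hg0.trans_le (hdot _ (hη _)).1)]
          exact mul_le_mul_of_nonneg_right (hdot _ (hη _)).2 (norm_nonneg _)
        have := a1.sub a2
        rw [sub_zero] at this
        refine this.congr fun n => ?_
        simp only [poissonSol, sub_smul, smul_sub, one_smul]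
        abel
      simpa using ((l1.add hφθ).add l2).add l3
    · intro n
      have h1 := hpoisson (n + 1)
      rw [hφ]
      ext i
      have h1i := congrFun h1 i
      have h2i := congrFun (hrec n) i
      have h3 : γ n * (γ (n + 1) / γ n) = γ (n + 1) := mul_div_cancel₀ _ (hγ0 n).ne'
      simp only [Pi.add_apply, Pi.sub_apply, Pi.smul_apply, smul_eq_mul, add_assoc,
        Nat.reduceAdd] at h1i h2i ⊢
      linear_combination h2i + γ n * h1i - poissonSol G (η (n + 2)) (θ (n + 2)) i * h3
  simpa using hφlim.sub hφθ

/-- The sub-stochastic matrix of the chain killed at `0`. -/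
def subMat {d : ℕ} (P : Matrix (Fin (d + 1)) (Fin (d + 1)) ℝ) : Matrix (Fin d) (Fin d) ℝ :=
  Matrix.of fun x y => P x.succ y.succ

lemma vecMul_Kmat {d : ℕ} (P : Matrix (Fin (d + 1)) (Fin (d + 1)) ℝ) (w ν : Fin d → ℝ) :
    w ᵥ* Kmat P ν = w ᵥ* subMat P + (w ⬝ᵥ fun x => P x.succ 0) • ν := by
  ext y
  simp only [vecMul, dotProduct, Kmat, subMat, Matrix.of_apply, Pi.add_apply, Pi.smul_apply,
    smul_eq_mul, sum_mul, ← sum_add_distrib]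
  exact sum_congr rfl fun x _ => by ring

/-- A strictly positive Green kernel inverts `1 - subMat P`, and the invariant distributions are
obtained by normalising its action. -/
lemma exists_green {d : ℕ} {P : Matrix (Fin (d + 1)) (Fin (d + 1)) ℝ}
    {pi : (Fin d → ℝ) → Fin d → ℝ} (hS : Setup d P pi) :
    ∃ G : Matrix (Fin d) (Fin d) ℝ, (∀ x y, 0 < G x y) ∧ (1 - subMat P) * G = 1 ∧
      ∀ ν ∈ simplex d, pi ν = normVecMul G ν := by
  have hinv : ∀ ν ∈ simplex d,
      pi ν ᵥ* subMat P + (pi ν ⬝ᵥ fun x => P x.succ 0) • ν = pi ν := fun ν hν => by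
    rw [← vecMul_Kmat]
    ext y
    exact hS.pi_invariant ν hν y
  have hq : ∀ ν ∈ simplex d, 0 ≤ pi ν ⬝ᵥ fun x => P x.succ 0 := fun ν hν =>
    sum_nonneg fun x _ => mul_nonneg ((hS.pi_mem ν hν).1 x) (hS.P_nonneg _ _)
  have hQ0 : ∀ x y, 0 ≤ subMat P x y := fun x y => hS.P_nonneg _ _
  have hQn : ∀ n x y, 0 ≤ (subMat P ^ n) x y := by
    intro n
    induction n with
    | zero => intro x y; rw [pow_zero, one_apply]; split_ifs <;> norm_num
    | succ n ih =>
      intro x y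
      rw [pow_succ, mul_apply]
      exact sum_nonneg fun z _ => mul_nonneg (ih x z) (hQ0 z y)
  have hle : ∀ ν ∈ simplex d, ∀ n y, (pi ν ᵥ* subMat P ^ n) y ≤ pi ν y := by
    intro ν hν n
    induction n with
    | zero => simp
    | succ n ih =>
      intro y
      rw [pow_succ, ← vecMul_vecMul]
      calc ((pi ν ᵥ* subMat P ^ n) ᵥ* subMat P) y ≤ (pi ν ᵥ* subMat P) y := by
            change ∑ x, (pi ν ᵥ* subMat P ^ n) x * subMat P x y ≤ ∑ x, pi ν x * subMat P x y
            exact sum_le_sum fun x _ => mul_le_mul_of_nonneg_right (ih x) (hQ0 x y)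
        _ ≤ pi ν y := by
          conv_rhs => rw [← hinv ν hν]
          simp only [Pi.add_apply, Pi.smul_apply, smul_eq_mul, le_add_iff_nonneg_right]
          exact mul_nonneg (hq ν hν) (hν.1 y)
  have hpos : ∀ ν ∈ simplex d, ∀ y, 0 < pi ν y := by
    intro ν hν y
    obtain ⟨x, -, hx⟩ : ∃ x ∈ univ, (0 : ℝ) < pi ν x := by
      refine exists_lt_of_sum_lt ?_
      rw [sum_const_zero, (hS.pi_mem ν hν).2]; exact one_pos
    obtain ⟨n, hn⟩ := hS.P_irred x y
    calc 0 < pi ν x * (subMat P ^ n) x y := mul_pos hx hn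
      _ ≤ (pi ν ᵥ* subMat P ^ n) y :=
        single_le_sum (f := fun x => pi ν x * (subMat P ^ n) x y)
          (fun z _ => mul_nonneg ((hS.pi_mem ν hν).1 z) (hQn n z y)) (mem_univ x)
      _ ≤ pi ν y := hle ν hν n y
  have hqpos : ∀ ν ∈ simplex d, 0 < pi ν ⬝ᵥ fun x => P x.succ 0 := by
    intro ν hν
    obtain ⟨x, hx⟩ := hS.P_killed
    exact (mul_pos (hpos ν hν x) hx).trans_le
      (single_le_sum (f := fun x => pi ν x * P x.succ 0)
        (fun z _ => mul_nonneg ((hS.pi_mem ν hν).1 z) (hS.P_nonneg _ _)) (mem_univ x))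
  have hsingle : ∀ x : Fin d, (Pi.single x 1 : Fin d → ℝ) ∈ simplex d := fun x =>
    ⟨fun i => by rw [Pi.single_apply]; split_ifs <;> norm_num, by simp⟩
  let G : Matrix (Fin d) (Fin d) ℝ := Matrix.of fun x =>
    (pi (Pi.single x 1) ⬝ᵥ fun x => P x.succ 0)⁻¹ • pi (Pi.single x 1)
  have hG1 : G * (1 - subMat P) = 1 := by
    ext x y
    have h0 := hqpos _ (hsingle x)
    have h1 := congrFun (hinv _ (hsingle x)) y
    have h2 : (G * (1 - subMat P)) x y = (((pi (Pi.single x 1) ⬝ᵥ fun x => P x.succ 0)⁻¹ •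
      pi (Pi.single x 1)) ᵥ* (1 - subMat P)) y := rfl
    rw [h2, smul_vecMul, vecMul_sub, vecMul_one, one_apply]
    simp only [Pi.sub_apply, Pi.smul_apply, smul_eq_mul, Pi.add_apply] at h1 ⊢
    rw [inv_mul_eq_iff_eq_mul₀ h0.ne']
    rw [Pi.single_apply] at h1
    simp only [eq_comm (a := y)] at h1
    linarith
  have hG2 : (1 - subMat P) * G = 1 := mul_eq_one_comm.1 hG1
  refine ⟨G, fun x y => ?_, hG2, fun ν hν => ?_⟩
  · simp only [G, Matrix.of_apply, Pi.smul_apply, smul_eq_mul]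
    exact mul_pos (inv_pos.2 (hqpos _ (hsingle x))) (hpos _ (hsingle x) y)
  · have h0 := hqpos ν hν
    obtain ⟨c, hc⟩ : ∃ c, c = pi ν ⬝ᵥ fun x => P x.succ 0 := ⟨_, rfl⟩
    have h1 := hinv ν hν
    rw [← hc] at h0 h1
    have h2 : pi ν ᵥ* (1 - subMat P) = c • ν := by
      rw [vecMul_sub, vecMul_one, sub_eq_iff_eq_add, add_comm, h1]
    have h3 : pi ν = c • (ν ᵥ* G) := by
      rw [← smul_vecMul, ← h2, vecMul_vecMul, hG2, vecMul_one]
    have h4 : 1 = c * (ν ⬝ᵥ (G *ᵥ 1)) := by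
      rw [dotProduct_mulVec, ← smul_eq_mul, ← smul_dotProduct, ← h3, dotProduct_one,
        (hS.pi_mem ν hν).2]
    have h5 : ν ⬝ᵥ (G *ᵥ 1) = c⁻¹ := eq_inv_of_mul_eq_one_right h4.symm
    rw [normVecMul, h5, inv_inv, h3]

lemma gam_succ (γs : ℝ) (n : ℕ) : gam γs (n + 1) = γs * ((n + (⌊γs⌋₊ + 1) : ℕ) : ℝ)⁻¹ := by
  unfold gam
  push_cast
  rw [div_eq_mul_inv]
  congr 2
  ring

lemma gam_succ_pos {γs : ℝ} (h : 0 < γs) (n : ℕ) : 0 < gam γs (n + 1) := by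
  rw [gam_succ]; positivity

lemma gam_succ_le_one {γs : ℝ} (n : ℕ) : gam γs (n + 1) ≤ 1 := by
  rw [gam_succ, ← div_eq_mul_inv, div_le_one (by positivity)]
  have := (Nat.lt_floor_add_one γs).le
  push_cast
  linarith [(Nat.cast_nonneg n : (0 : ℝ) ≤ n)]

lemma tendsto_gam (γs : ℝ) : Tendsto (fun n => gam γs (n + 1)) atTop (𝓝 0) := by
  simp only [gam_succ]
  simpa using ((tendsto_inv_atTop_nhds_zero_nat (𝕜 := ℝ)).comp
    (tendsto_add_atTop_nat (⌊γs⌋₊ + 1))).const_mul γs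

lemma tendsto_sum_gam {γs : ℝ} (h : 0 < γs) :
    Tendsto (fun n => ∑ i ∈ range n, gam γs (i + 1)) atTop atTop := by
  rw [← not_summable_iff_tendsto_nat_atTop_of_nonneg fun n => (gam_succ_pos h n).le]
  simp only [gam_succ]
  rw [summable_mul_left_iff h.ne',
    summable_nat_add_iff (f := fun n : ℕ => (n : ℝ)⁻¹) (⌊γs⌋₊ + 1)]
  exact Real.not_summable_natCast_inv

lemma tendsto_gam_ratio {γs : ℝ} (h : 0 < γs) :
    Tendsto (fun n => gam γs (n + 1 + 1) / gam γs (n + 1)) atTop (𝓝 1) := by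
  have := (tendsto_natCast_div_add_atTop (1 : ℝ)).comp (tendsto_add_atTop_nat (⌊γs⌋₊ + 1))
  refine this.congr fun n => ?_
  simp only [gam_succ, Function.comp]
  push_cast
  field_simp
  ring

lemma SeqA.pos {ζ : ℝ} {a : ℕ → ℕ} (ha : SeqA ζ a) (n : ℕ) : 0 < a n := by
  have := ha.mono (Nat.zero_le n)
  rw [ha.zero] at this
  exact this

lemma SeqA.rpow_le {ζ : ℝ} (hζ : ζ ∈ Set.Ioo (0 : ℝ) 1) {a : ℕ → ℕ} (ha : SeqA ζ a) (n : ℕ) :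
    (n : ℝ) ^ ζ ≤ a n + 1 := by
  by_contra! hlt
  have hp : 1 ≤ 1 / ζ := by rw [le_div_iff₀ hζ.1]; linarith [hζ.2]
  have h1 : (((a n + 1 : ℕ) : ℝ)) ^ (1 / ζ) ≤ n := by
    have := Real.rpow_le_rpow (by positivity) hlt.le (show 0 ≤ 1 / ζ by linarith)
    rw [← Real.rpow_mul (Nat.cast_nonneg n), mul_one_div_cancel hζ.1.ne', Real.rpow_one] at this
    exact_mod_cast this
  have h2 : ⌊((a n + 1 : ℕ) : ℝ) ^ (1 / ζ)⌋₊ ≤ n := Nat.floor_le_of_le h1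
  have h3 : ⌊((a n + 1 : ℕ) : ℝ) ^ (1 / ζ)⌋₊ < ⌊(((a n + 1 : ℕ) : ℝ) + 1) ^ (1 / ζ)⌋₊ := by
    rw [← Nat.succ_le_iff, Nat.succ_eq_add_one, ← Nat.floor_add_one (by positivity)]
    refine Nat.floor_le_floor ?_
    have := Real.add_rpow_le_rpow_add (Nat.cast_nonneg (a n + 1)) zero_le_one hp
    rwa [Real.one_rpow] at this
  have h4 := ha.count (a n + 1) _ (by omega) le_rfl h3
  have h5 := ha.mono h2
  omega

lemma SeqA.tendsto {ζ : ℝ} (hζ : ζ ∈ Set.Ioo (0 : ℝ) 1) {a : ℕ → ℕ} (ha : SeqA ζ a) :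
    Tendsto (fun n => (a n : ℝ)) atTop atTop := by
  have h : Tendsto (fun n : ℕ => (n : ℝ) ^ ζ - 1) atTop atTop :=
    tendsto_atTop_add_const_right _ _
      ((tendsto_rpow_atTop hζ.1).comp tendsto_natCast_atTop_atTop)
  exact tendsto_atTop_mono (fun n => by linarith [ha.rpow_le hζ n]) h

lemma SeqA.summable_exp {ζ : ℝ} (hζ : ζ ∈ Set.Ioo (0 : ℝ) 1) {a : ℕ → ℕ} (ha : SeqA ζ a)
    {b : ℝ} (hb : 0 < b) : Summable fun n => Real.exp (-(b * a (n + 1))) := by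
  rw [summable_nat_add_iff (f := fun n => Real.exp (-(b * a n)))]
  have h1 := (isLittleO_exp_neg_mul_rpow_atTop hb (-(2 / ζ))).isBigO.comp_tendsto
    ((tendsto_rpow_atTop hζ.1).comp tendsto_natCast_atTop_atTop)
  have h2 : Summable fun n : ℕ => (n : ℝ) ^ (-2 : ℝ) := by
    rw [Real.summable_nat_rpow]; norm_num
  have h3 : Summable fun n : ℕ => Real.exp (-b * (n : ℝ) ^ ζ) := by
    refine summable_of_isBigO_nat h2 (h1.congr (fun n => rfl) fun n => ?_)
    simp only [Function.comp]
    rw [← Real.rpow_mul (Nat.cast_nonneg n)]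
    congr 1
    field_simp [hζ.1.ne']
  refine Summable.of_nonneg_of_le (fun n => (Real.exp_pos _).le) (fun n => ?_)
    (h3.mul_left (Real.exp b))
  rw [← Real.exp_add]
  refine Real.exp_le_exp.2 ?_
  nlinarith [ha.rpow_le hζ n]

lemma sum_mul_exp_le {d : ℕ} {p : Fin d → ℝ} (hp : p ∈ simplex d) (y : Fin d) {s : ℝ}
    (hs : |s| ≤ 1) :
    ∑ w, p w * Real.exp (s * ((if w = y then 1 else 0) - p y)) ≤ Real.exp (s ^ 2) := by
  have hp1 : p y ≤ 1 := hp.2 ▸ single_le_sum (fun j _ => hp.1 j) (mem_univ y)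
  have hx : ∀ w, |((if w = y then 1 else 0) - p y : ℝ)| ≤ 1 := fun w => by
    have := hp.1 y
    rw [abs_le]
    split_ifs <;> constructor <;> linarith
  have hw : ∀ w, p w * Real.exp (s * ((if w = y then 1 else 0) - p y)) ≤
      p w * (1 + s ^ 2) + s * (p w * (if w = y then 1 else 0) - p w * p y) := fun w => by
    have h1 : |s * ((if w = y then 1 else 0) - p y)| ≤ 1 := by
      rw [abs_mul]; exact mul_le_one₀ hs (abs_nonneg _) (hx w)
    have h2 := (abs_le.1 (Real.abs_exp_sub_one_sub_id_le h1)).2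
    have h3 : (s * ((if w = y then 1 else 0) - p y)) ^ 2 ≤ s ^ 2 := by
      rw [mul_pow]
      exact mul_le_of_le_one_right (sq_nonneg s) (by
        rw [← sq_abs]; exact pow_le_one₀ (abs_nonneg _) (hx w))
    have h4 := mul_le_mul_of_nonneg_left (a := p w) (h2.trans h3) (hp.1 w)
    linarith
  refine (sum_le_sum fun w _ => hw w).trans ?_
  rw [sum_add_distrib, ← sum_mul, hp.2, ← mul_sum, sum_sub_distrib, ← sum_mul, hp.2]
  simp only [mul_ite, mul_one, mul_zero, sum_ite_eq', mem_univ, if_true, one_mul, sub_self,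
    add_zero]
  linarith [Real.add_one_le_exp (s ^ 2)]

section Concentration

variable {Ω : Type*} {m m0 : MeasurableSpace Ω} {μ : Measure Ω} [IsProbabilityMeasure μ]
  {d N : ℕ} {Y : Fin N → Ω → Fin d} {κ : Fin N → Ω → Fin d → ℝ}

/-- Exponential moments of the counts of conditionally independent variables. -/
lemma integral_exp_count_le (hm : m ≤ m0) (hY : ∀ i, Measurable (Y i))
    (hκm : ∀ i w, Measurable[m] fun ω => κ i ω w) (hκ : ∀ i ω, κ i ω ∈ simplex d)
    (hlaw : ∀ z : Fin N → Fin d,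
      μ[Set.indicator {ω | ∀ i, Y i ω = z i} (fun _ => (1 : ℝ)) | m]
        =ᵐ[μ] fun ω => ∏ i, κ i ω (z i)) (y : Fin d) {s : ℝ} (hs : |s| ≤ 1) :
    ∫ ω, Real.exp (s * ∑ i, ((if Y i ω = y then 1 else 0) - κ i ω y)) ∂μ ≤
      Real.exp (N * s ^ 2) := by
  obtain ⟨f, hf⟩ : ∃ f : (Fin N → Fin d) → Ω → ℝ, f = fun z ω =>
    ∏ i, Real.exp (s * ((if z i = y then 1 else 0) - κ i ω y)) := ⟨_, rfl⟩
  have hfm : ∀ z, Measurable[m] (f z) := fun z => by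
    rw [hf]
    refine Finset.measurable_fun_prod _ fun i _ => ?_
    exact Real.measurable_exp.comp ((measurable_const.sub (hκm i y)).const_mul s)
  have hfb : ∀ z ω, ‖f z ω‖ ≤ Real.exp 1 ^ N := fun z ω => by
    rw [hf]
    simp only [norm_prod]
    refine (prod_le_prod (fun _ _ => norm_nonneg _) (g := fun _ => Real.exp 1) fun i _ => ?_).trans
      (by simp)
    rw [Real.norm_eq_abs, Real.abs_exp, Real.exp_le_exp]
    refine (le_abs_self _).trans ?_
    rw [abs_mul]
    refine mul_le_one₀ hs (abs_nonneg _) ?_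
    have h0 := (hκ i ω).1 y
    have h1 : κ i ω y ≤ 1 := (hκ i ω).2 ▸ single_le_sum (fun j _ => (hκ i ω).1 j) (mem_univ y)
    rw [abs_le]
    split_ifs <;> constructor <;> linarith
  obtain ⟨A, hA⟩ : ∃ A : (Fin N → Fin d) → Set Ω, A = fun z => {ω | ∀ i, Y i ω = z i} := ⟨_, rfl⟩
  have hAm : ∀ z, MeasurableSet (A z) := fun z => by
    rw [hA]
    simp only [Set.ofPred_forall]
    exact MeasurableSet.iInter fun i => hY i (measurableSet_singleton _)
  have hint1 : ∀ z, Integrable ((A z).indicator fun _ => (1 : ℝ)) μ := fun z =>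
    (integrable_const 1).indicator (hAm z)
  have hint2 : ∀ z, Integrable (f z * (A z).indicator fun _ => (1 : ℝ)) μ := fun z =>
    (hint1 z).bdd_mul ((hfm z).mono hm le_rfl).aestronglyMeasurable
      (Eventually.of_forall (hfb z))
  have hdecomp : (fun ω => Real.exp (s * ∑ i, ((if Y i ω = y then 1 else 0) - κ i ω y))) =
      fun ω => ∑ z, (f z * (A z).indicator fun _ => (1 : ℝ)) ω := by
    ext ω
    rw [sum_eq_single (fun i => Y i ω)]
    · rw [hf, hA, mul_sum, Real.exp_sum]
      simp
    · intro z _ hz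
      have : ω ∉ A z := fun h => hz (by rw [hA] at h; exact funext fun i => (h i).symm)
      simp [this]
    · simp
  have hκm0 : ∀ i w, Measurable fun ω => κ i ω w := fun i w => (hκm i w).mono hm le_rfl
  have hκ1 : ∀ i ω w, κ i ω w ≤ 1 := fun i ω w =>
    (hκ i ω).2 ▸ single_le_sum (fun j _ => (hκ i ω).1 j) (mem_univ w)
  have hint3 : ∀ z, Integrable (fun ω => f z ω * ∏ i, κ i ω (z i)) μ := fun z => by
    refine Integrable.of_bound ?_ (Real.exp 1 ^ N * 1) (Eventually.of_forall fun ω => ?_)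
    · exact (((hfm z).mono hm le_rfl).mul
        (Finset.measurable_fun_prod _ fun i _ => hκm0 i (z i))).aestronglyMeasurable
    · rw [norm_mul]
      refine mul_le_mul (hfb z ω) ?_ (norm_nonneg _) (by positivity)
      rw [norm_prod]
      refine prod_le_one (fun _ _ => norm_nonneg _) fun i _ => ?_
      rw [Real.norm_eq_abs, abs_of_nonneg ((hκ i ω).1 _)]
      exact hκ1 _ _ _
  have hterm : ∀ z, ∫ ω, (f z * (A z).indicator fun _ => (1 : ℝ)) ω ∂μ =
      ∫ ω, f z ω * ∏ i, κ i ω (z i) ∂μ := fun z => by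
    rw [← integral_condExp hm]
    refine integral_congr_ae ?_
    have h1 := condExp_mul_of_stronglyMeasurable_left (hfm z).stronglyMeasurable (hint2 z)
      (hint1 z)
    have h2 := hlaw z
    rw [hA] at h1 ⊢
    filter_upwards [h1, h2] with ω h1 h2
    rw [h1, Pi.mul_apply, h2]
  rw [hdecomp, integral_finsetSum _ fun z _ => hint2 z]
  simp only [hterm]
  rw [← integral_finsetSum _ fun z _ => hint3 z]
  have hpt : ∀ ω, ∑ z, f z ω * ∏ i, κ i ω (z i) ≤ Real.exp (N * s ^ 2) := fun ω => by
    calc ∑ z, f z ω * ∏ i, κ i ω (z i)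
        = ∏ i, ∑ w, κ i ω w * Real.exp (s * ((if w = y then 1 else 0) - κ i ω y)) := by
          rw [prod_univ_sum, Fintype.piFinset_univ]
          refine sum_congr rfl fun z _ => ?_
          rw [hf, ← prod_mul_distrib]
          exact prod_congr rfl fun i _ => mul_comm _ _
      _ ≤ ∏ _i : Fin N, Real.exp (s ^ 2) :=
          prod_le_prod (fun i _ => sum_nonneg fun w _ =>
            mul_nonneg ((hκ i ω).1 w) (Real.exp_pos _).le) fun i _ => sum_mul_exp_le (hκ i ω) y hs
      _ = Real.exp (N * s ^ 2) := by rw [prod_const, card_univ, Fintype.card_fin, ← Real.exp_nat_mul]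
  calc _ ≤ ∫ _ω, Real.exp (N * s ^ 2) ∂μ :=
        integral_mono (integrable_finsetSum _ fun z _ => hint3 z) (integrable_const _) hpt
    _ = _ := by simp

lemma measure_count_deviation_le (hm : m ≤ m0) (hY : ∀ i, Measurable (Y i))
    (hκm : ∀ i w, Measurable[m] fun ω => κ i ω w) (hκ : ∀ i ω, κ i ω ∈ simplex d)
    (hlaw : ∀ z : Fin N → Fin d,
      μ[Set.indicator {ω | ∀ i, Y i ω = z i} (fun _ => (1 : ℝ)) | m]
        =ᵐ[μ] fun ω => ∏ i, κ i ω (z i)) (y : Fin d) {t : ℝ} (ht0 : 0 ≤ t) (ht : t ≤ 1) :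
    μ {ω | t * N ≤ |∑ i, ((if Y i ω = y then 1 else 0) - κ i ω y)|} ≤
      ENNReal.ofReal (2 * Real.exp (-(t ^ 2 / 4 * N))) := by
  obtain ⟨S, hS⟩ : ∃ S : Ω → ℝ, S = fun ω => ∑ i, ((if Y i ω = y then 1 else 0) - κ i ω y) :=
    ⟨_, rfl⟩
  have hSm : Measurable S := by
    rw [hS]
    refine Finset.measurable_fun_sum _ fun i _ => Measurable.sub ?_ ((hκm i y).mono hm le_rfl)
    exact Measurable.ite (hY i (measurableSet_singleton y)) measurable_const measurable_const
  have hSb : ∀ ω, |S ω| ≤ N := fun ω => by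
    rw [hS]
    refine (abs_sum_le_sum_abs _ _).trans ?_
    refine (sum_le_sum (g := fun _ => (1 : ℝ)) fun i _ => ?_).trans (by simp)
    have h0 := (hκ i ω).1 y
    have h1 : κ i ω y ≤ 1 := (hκ i ω).2 ▸ single_le_sum (fun j _ => (hκ i ω).1 j) (mem_univ y)
    rw [abs_le]
    split_ifs <;> constructor <;> linarith
  have h_int : ∀ s : ℝ, Integrable (fun ω => Real.exp (s * S ω)) μ := fun s => by
    refine Integrable.of_bound (Real.measurable_exp.comp (hSm.const_mul s)).aestronglyMeasurable
      (Real.exp (|s| * N)) (Eventually.of_forall fun ω => ?_)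
    rw [Real.norm_eq_abs, Real.abs_exp, Real.exp_le_exp]
    refine (le_abs_self _).trans ?_
    rw [abs_mul]
    exact mul_le_mul_of_nonneg_left (hSb ω) (abs_nonneg s)
  have hmgf : ∀ s : ℝ, |s| ≤ 1 → mgf S μ s ≤ Real.exp (N * s ^ 2) := fun s hs => by
    rw [mgf, hS]
    exact integral_exp_count_le hm hY hκm hκ hlaw y hs
  have h1 : μ.real {ω | t * N ≤ S ω} ≤ Real.exp (-(t ^ 2 / 4 * N)) := by
    refine (measure_ge_le_exp_mul_mgf (t * N) (by positivity : 0 ≤ t / 2) (h_int _)).trans ?_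
    refine (mul_le_mul_of_nonneg_left (hmgf (t / 2) ?_) (Real.exp_pos _).le).trans ?_
    · rw [abs_of_nonneg (by positivity)]; linarith
    · rw [← Real.exp_add, Real.exp_le_exp]; apply le_of_eq; ring
  have h2 : μ.real {ω | S ω ≤ -(t * N)} ≤ Real.exp (-(t ^ 2 / 4 * N)) := by
    refine (measure_le_le_exp_mul_mgf (-(t * N)) (by linarith : -(t / 2) ≤ 0) (h_int _)).trans ?_
    refine (mul_le_mul_of_nonneg_left (hmgf (-(t / 2)) ?_) (Real.exp_pos _).le).trans ?_
    · rw [abs_neg, abs_of_nonneg (by positivity)]; linarith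
    · rw [← Real.exp_add, Real.exp_le_exp]; apply le_of_eq; ring
  have hsub : {ω | t * N ≤ |S ω|} ⊆ {ω | t * N ≤ S ω} ∪ {ω | S ω ≤ -(t * N)} := fun ω hω => by
    rcases le_abs.1 (show t * N ≤ |S ω| from hω) with h | h
    · exact Or.inl h
    · exact Or.inr (show S ω ≤ -(t * N) by linarith)
  have h3 : μ.real {ω | t * N ≤ |S ω|} ≤ 2 * Real.exp (-(t ^ 2 / 4 * N)) :=
    (measureReal_mono hsub).trans ((measureReal_union_le _ _).trans (by linarith))
  rw [hS] at h3
  rw [← ofReal_measureReal]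
  exact ENNReal.ofReal_le_ofReal h3

end Concentration

lemma Kmat_mem_simplex {d : ℕ} {P : Matrix (Fin (d + 1)) (Fin (d + 1)) ℝ}
    {pi : (Fin d → ℝ) → Fin d → ℝ} (hS : Setup d P pi) {ν : Fin d → ℝ} (hν : ν ∈ simplex d)
    (x : Fin d) : Kmat P ν x ∈ simplex d := by
  refine ⟨fun y => add_nonneg (hS.P_nonneg _ _) (mul_nonneg (hS.P_nonneg _ _) (hν.1 y)), ?_⟩
  simp only [Kmat, Matrix.of_apply]
  rw [sum_add_distrib, ← mul_sum, hν.2, mul_one, add_comm, ← Fin.sum_univ_succ,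
    hS.P_rowsum]

/-- The empirical measure of the points `x 0, …, x (N - 1)`. -/
def empirical {d : ℕ} (N : ℕ) (x : ℕ → Fin d) : Fin d → ℝ :=
  fun y => (N : ℝ)⁻¹ * ∑ i ∈ range N, if x i = y then 1 else 0

lemma empirical_mem_simplex {d N : ℕ} (hN : 0 < N) (x : ℕ → Fin d) :
    empirical N x ∈ simplex d := by
  have hN' : (N : ℝ) ≠ 0 := by positivity
  refine ⟨fun y => mul_nonneg (by positivity) (sum_nonneg fun i _ => ?_), ?_⟩
  · split_ifs <;> norm_num
  · simp only [empirical]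
    rw [← mul_sum, sum_comm]
    simp [hN']

lemma empirical_vecMul {d : ℕ} (N : ℕ) (x : ℕ → Fin d) (K : Matrix (Fin d) (Fin d) ℝ)
    (y : Fin d) : (empirical N x ᵥ* K) y = (N : ℝ)⁻¹ * ∑ i ∈ range N, K (x i) y := by
  simp only [vecMul, dotProduct, empirical, mul_assoc, sum_mul, ← mul_sum]
  rw [sum_comm]
  simp

lemma abs_average_succ_sub_le {N : ℕ} (hN : 0 < N) {f : ℕ → ℝ} (hf0 : ∀ i, 0 ≤ f i)
    (hf1 : ∀ i, f i ≤ 1) :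
    |((N + 1 : ℕ) : ℝ)⁻¹ * ∑ i ∈ range (N + 1), f i - (N : ℝ)⁻¹ * ∑ i ∈ range N, f i| ≤
      (N : ℝ)⁻¹ := by
  have hN' : (0 : ℝ) < N := by positivity
  have h0 : 0 ≤ ∑ i ∈ range N, f i := sum_nonneg fun i _ => hf0 i
  have h1 : ∑ i ∈ range N, f i ≤ N :=
    (sum_le_sum (g := fun _ => (1 : ℝ)) fun i _ => hf1 i).trans (by simp)
  have h2 : ((N + 1 : ℕ) : ℝ)⁻¹ * ∑ i ∈ range (N + 1), f i - (N : ℝ)⁻¹ * ∑ i ∈ range N, f i =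
      (N : ℝ)⁻¹ * ((N * f N - ∑ i ∈ range N, f i) / (N + 1)) := by
    rw [sum_range_succ]
    push_cast
    field_simp
    ring
  rw [h2, abs_mul, abs_of_pos (inv_pos.2 hN')]
  refine mul_le_of_le_one_right (inv_nonneg.2 hN'.le) ?_
  have h3 : (N : ℝ) * f N ≤ N := mul_le_of_le_one_right hN'.le (hf1 N)
  have h4 : 0 ≤ (N : ℝ) * f N := mul_nonneg hN'.le (hf0 N)
  rw [abs_le, le_div_iff₀ (by positivity), div_le_iff₀ (by positivity)]
  constructor <;> linarith

namespace AlgorithmII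

variable {d : ℕ} {P : Matrix (Fin (d + 1)) (Fin (d + 1)) ℝ} {pi : (Fin d → ℝ) → Fin d → ℝ}
  {γs ζ : ℝ} {a : ℕ → ℕ} {x0 : Fin d} {Ω : Type} [MeasurableSpace Ω] {μ : Measure Ω}

/-- The empirical measure of the particles at time `n`. -/
def occupation (B : AlgorithmII d P γs a x0 Ω μ) (n : ℕ) (ω : Ω) : Fin d → ℝ :=
  empirical (a n) fun i => B.X n i ω

lemma theta_succ (B : AlgorithmII d P γs a x0 Ω μ) (n : ℕ) (ω : Ω) :
    B.theta (n + 1) ω =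
      B.theta n ω + gam γs (n + 1) • (B.occupation (n + 1) ω - B.theta n ω) := by
  ext x
  rw [B.theta_rec]
  simp only [occupation, empirical, Pi.add_apply, Pi.smul_apply, Pi.sub_apply, smul_eq_mul]
  ring

lemma theta_mem_simplex (hγ : 0 < γs) (ha : SeqA ζ a) (B : AlgorithmII d P γs a x0 Ω μ)
    (n : ℕ) (ω : Ω) : B.theta n ω ∈ simplex d := by
  induction n with
  | zero =>
    rw [B.theta_zero]
    exact ⟨fun i => by dsimp only; split_ifs <;> norm_num, by simp⟩
  | succ n ih =>
    have h1 := empirical_mem_simplex (ha.pos (n + 1)) fun i => B.X (n + 1) i ω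
    have h := convex_stdSimplex ℝ (Fin d) ih h1
      (sub_nonneg.2 (gam_succ_le_one (γs := γs) n)) (gam_succ_pos hγ n).le (by ring)
    have h2 : B.theta (n + 1) ω = (1 - gam γs (n + 1)) • B.theta n ω +
        gam γs (n + 1) • empirical (a (n + 1)) fun i => B.X (n + 1) i ω := by
      rw [B.theta_succ, occupation, smul_sub, sub_smul, one_smul]
      abel
    rw [h2]
    exact h

lemma measurable_Kmat (B : AlgorithmII d P γs a x0 Ω μ) (n i : ℕ) (w : Fin d) :
    Measurable[B.F n] fun ω => Kmat P (B.theta n ω) (B.X n i ω) w := by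
  have h1 : ∀ f : Fin d → ℝ, Measurable[B.F n] fun ω => f (B.X n i ω) := fun f =>
    (measurable_of_finite f).comp (B.X_adapted n i)
  have h2 : Measurable[B.F n] fun ω => B.theta n ω w :=
    (measurable_pi_apply w).comp (B.theta_adapted n)
  exact (h1 fun x => P x.succ w.succ).add ((h1 fun x => P x.succ 0).mul h2)

variable [IsProbabilityMeasure μ]

/-- The first `a (n + 1)` particles move conditionally independently, branching or not. -/
lemma law_particles (hS : Setup d P pi) (hγ : 0 < γs) (ha : SeqA ζ a)
    (B : AlgorithmII d P γs a x0 Ω μ) (n : ℕ) (y : ℕ → Fin d) :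
    (μ[Set.indicator {ω | ∀ i < a (n + 1), B.X (n + 1) i ω = y i} (fun _ => (1 : ℝ)) | B.F n])
      =ᵐ[μ] fun ω =>
        ∏ i ∈ range (a (n + 1)), Kmat P (B.theta n ω) (B.X n i ω) (y i) := by
  rcases (show a (n + 2) = a (n + 1) ∨ a (n + 2) = a (n + 1) + 1 by
    have h1 := ha.step (n + 1)
    have h2 := ha.mono (Nat.le_succ (n + 1))
    simp only [Nat.succ_eq_add_one, add_assoc, Nat.reduceAdd] at h1 h2
    omega) with h | h
  · have := B.law_no_branch n y h
    rwa [h] at this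
  · obtain ⟨z, hz⟩ : ∃ z : Fin d → ℕ → Fin d, z = fun w => Function.update y (a (n + 1)) w :=
      ⟨_, rfl⟩
    have hzlt : ∀ w, ∀ i < a (n + 1), z w i = y i := fun w i hi => by
      rw [hz]; exact Function.update_of_ne hi.ne _ _
    have hzeq : ∀ w, z w (a (n + 1)) = w := fun w => by
      rw [hz]; exact Function.update_self ..
    have hdecomp : Set.indicator {ω | ∀ i < a (n + 1), B.X (n + 1) i ω = y i} (fun _ => (1 : ℝ)) =
        ∑ w, Set.indicator {ω | ∀ i < a (n + 2), B.X (n + 1) i ω = z w i}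
          (fun _ => (1 : ℝ)) := by
      ext ω
      have hmem : ∀ w, (∀ i < a (n + 2), B.X (n + 1) i ω = z w i) ↔
          (∀ i < a (n + 1), B.X (n + 1) i ω = y i) ∧ B.X (n + 1) (a (n + 1)) ω = w := fun w => by
        rw [h, Nat.forall_lt_succ_right, hzeq]
        exact and_congr_left fun _ => forall₂_congr fun i hi => by rw [hzlt w i hi]
      classical
      simp only [Finset.sum_apply, Set.indicator_apply, Set.mem_ofPred_eq, hmem, ite_and]
      simp
    have hmeas : ∀ w, MeasurableSet {ω | ∀ i < a (n + 2), B.X (n + 1) i ω = z w i} := fun w => by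
      simp only [Set.ofPred_forall]
      exact MeasurableSet.iInter fun i => MeasurableSet.iInter fun _ =>
        (B.X_adapted (n + 1) i).mono (B.F_le _) le_rfl (measurableSet_singleton _)
    rw [hdecomp]
    refine (condExp_finsetSum (fun w _ => (integrable_const (1 : ℝ)).indicator (hmeas w)) _).trans ?_
    have hlaw := eventually_all.2 fun w => B.law_branch n (z w) h
    filter_upwards [hlaw] with ω hω
    rw [Finset.sum_apply, sum_congr rfl fun w _ => hω w]
    have h1 : ∀ w, ∏ i ∈ range (a (n + 1)), Kmat P (B.theta n ω) (B.X n i ω) (z w i) =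
        ∏ i ∈ range (a (n + 1)), Kmat P (B.theta n ω) (B.X n i ω) (y i) := fun w =>
      prod_congr rfl fun i hi => by rw [hzlt w i (mem_range.1 hi)]
    simp only [h1, hzeq]
    rw [← mul_sum, (Kmat_mem_simplex hS (B.theta_mem_simplex hγ ha n ω) _).2, mul_one]

/-- The noise `η (n + 1) - E[η (n + 1) | F n]` vanishes asymptotically. -/
lemma ae_tendsto_noise (hS : Setup d P pi) (hγ : 0 < γs) (hζ : ζ ∈ Set.Ioo (0 : ℝ) 1)
    (ha : SeqA ζ a) (B : AlgorithmII d P γs a x0 Ω μ) (y : Fin d) :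
    ∀ᵐ ω ∂μ, Tendsto (fun n => B.occupation (n + 1) ω y - (a (n + 1) : ℝ)⁻¹ *
      ∑ i ∈ range (a (n + 1)), Kmat P (B.theta n ω) (B.X n i ω) y) atTop (𝓝 0) := by
  have key : ∀ k : ℕ, ∀ᵐ ω ∂μ, ∀ᶠ n in atTop,
      |∑ i : Fin (a (n + 1)), ((if B.X (n + 1) i ω = y then 1 else 0) -
        Kmat P (B.theta n ω) (B.X n i ω) y)| < (1 / ((k : ℝ) + 1)) * a (n + 1) := by
    intro k
    have hk0 : 0 < 1 / ((k : ℝ) + 1) := by positivity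
    have hk1 : 1 / ((k : ℝ) + 1) ≤ 1 := by
      rw [div_le_one (by positivity)]; linarith [(Nat.cast_nonneg k : (0 : ℝ) ≤ k)]
    have hle : ∀ n, μ {ω | (1 / ((k : ℝ) + 1)) * a (n + 1) ≤
        |∑ i : Fin (a (n + 1)), ((if B.X (n + 1) i ω = y then 1 else 0) -
          Kmat P (B.theta n ω) (B.X n i ω) y)|} ≤
        ENNReal.ofReal (2 * Real.exp (-((1 / ((k : ℝ) + 1)) ^ 2 / 4 * a (n + 1)))) := by
      intro n
      refine measure_count_deviation_le (m := B.F n) (N := a (n + 1))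
        (Y := fun i => B.X (n + 1) i) (κ := fun i ω => Kmat P (B.theta n ω) (B.X n i ω))
        (B.F_le n) (fun i => (B.X_adapted (n + 1) i).mono (B.F_le _) le_rfl)
        (fun i w => B.measurable_Kmat n i w)
        (fun i ω => Kmat_mem_simplex hS (B.theta_mem_simplex hγ ha n ω) _)
        (fun z => ?_) y hk0.le hk1
      have h1 := B.law_particles hS hγ ha n fun i => if h : i < a (n + 1) then z ⟨i, h⟩ else x0
      have h2 : {ω | ∀ i < a (n + 1), B.X (n + 1) i ω =
          if h : i < a (n + 1) then z ⟨i, h⟩ else x0} =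
          {ω | ∀ i : Fin (a (n + 1)), B.X (n + 1) i ω = z i} := by
        ext ω
        simp only [Set.mem_ofPred_eq, Fin.forall_iff]
        exact forall₂_congr fun i hi => by rw [dif_pos hi]
      rw [h2] at h1
      refine h1.trans (Eventually.of_forall fun ω => ?_)
      simp only [prod_range]
      exact prod_congr rfl fun i _ => by rw [dif_pos i.2]
    have hsum := ((ha.summable_exp hζ (b := (1 / ((k : ℝ) + 1)) ^ 2 / 4)
      (by positivity)).mul_left 2)
    have hfin := ne_top_of_le_ne_top hsum.tsum_ofReal_ne_top (ENNReal.tsum_le_tsum hle)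
    filter_upwards [ae_eventually_notMem hfin] with ω hω
    filter_upwards [hω] with n hn
    exact not_le.1 hn
  filter_upwards [ae_all_iff.2 key] with ω hω
  rw [Metric.tendsto_nhds]
  intro ε hε
  obtain ⟨k, hk⟩ := exists_nat_one_div_lt hε
  filter_upwards [hω k] with n hn
  have hapos : (0 : ℝ) < a (n + 1) := by exact_mod_cast ha.pos (n + 1)
  rw [dist_zero_right, occupation, empirical, ← mul_sub, ← sum_sub_distrib, norm_mul,
    Real.norm_eq_abs, Real.norm_eq_abs, abs_of_pos (inv_pos.2 hapos), inv_mul_lt_iff₀ hapos,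
    sum_range]
  calc _ < _ := hn
    _ < _ := by rw [mul_comm]; exact mul_lt_mul_of_pos_left hk hapos

end AlgorithmII

/-- **Theorem (a.s. convergence for Algorithm II).** `θ_n → θ*` almost surely. -/
theorem algorithmII_as_convergence
    {d : ℕ} (hd : 0 < d) (P : Matrix (Fin (d + 1)) (Fin (d + 1)) ℝ)
    (pi : (Fin d → ℝ) → Fin d → ℝ) (θs : Fin d → ℝ) (γs ζ : ℝ) (a : ℕ → ℕ) (x0 : Fin d)
    (Ω : Type) [MeasurableSpace Ω] (μ : Measure Ω) [IsProbabilityMeasure μ]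
    (hS : Setup d P pi) (hQSD : IsQSD d P pi θs) (hγpos : 0 < γs)
    (hζ : ζ ∈ Set.Ioo (0 : ℝ) 1) (ha : SeqA ζ a)
    (B : AlgorithmII d P γs a x0 Ω μ) :
    ∀ᵐ ω ∂μ, Tendsto (fun n => B.theta n ω) atTop (𝓝 θs) := by
  obtain ⟨G, hG, hGQ, hGpi⟩ := exists_green hS
  filter_upwards [ae_all_iff.2 (B.ae_tendsto_noise hS hγpos hζ ha)] with ω hω
  refine tendsto_of_asymptotic_kernel hd hG hGQ hQSD.mem (q := fun x => P x.succ 0)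
    ((hGpi θs hQSD.mem).symm.trans hQSD.fixed) (gam_succ_pos hγpos) (tendsto_gam γs)
    (tendsto_sum_gam hγpos) (tendsto_gam_ratio hγpos)
    (fun n => B.theta_mem_simplex hγpos ha n ω) (η := fun n => B.occupation n ω)
    (fun n => empirical_mem_simplex (ha.pos n) _) (fun n => B.theta_succ n ω) ?_
  rw [tendsto_pi_nhds]
  intro y
  have hK := fun n i => Kmat_mem_simplex hS (B.theta_mem_simplex hγpos ha n ω) (B.X n i ω)
  have hbranch : Tendsto (fun n => (a (n + 1) : ℝ)⁻¹ *
      ∑ i ∈ range (a (n + 1)), Kmat P (B.theta n ω) (B.X n i ω) y -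
      (B.occupation n ω ᵥ* Kmat P (B.theta n ω)) y) atTop (𝓝 0) := by
    refine squeeze_zero_norm (a := fun n => (a n : ℝ)⁻¹) (fun n => ?_)
      (tendsto_inv_atTop_zero.comp (ha.tendsto hζ))
    rw [AlgorithmII.occupation, empirical_vecMul]
    have h1 := ha.step n
    have h2 := ha.mono (Nat.le_succ n)
    rcases (show a (n + 1) = a n ∨ a (n + 1) = a n + 1 by
      simp only [Nat.succ_eq_add_one] at h2; omega) with h | h
    · rw [h, sub_self, norm_zero]; positivity
    · rw [h]
      exact abs_average_succ_sub_le (ha.pos n) (fun i => (hK n i).1 y) fun i =>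
        (hK n i).2 ▸ single_le_sum (fun j _ => (hK n i).1 j) (mem_univ y)
  have := (hω y).add hbranch
  rw [add_zero] at this
  refine this.congr fun n => ?_
  rw [← vecMul_Kmat, Pi.sub_apply]
  ring

end QSDPaper
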